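/- Let f, u : ℝⁿ → ℝ be smooth ℤⁿ-periodic functions and g : ℝⁿ → ℝ twice continuously differentiable. Writing v = v(∇u), one has ∫_{[0,1]ⁿ} [ ∇g(∇u)·∇(Δ_f u) + (D²u v)·(D²g(∇u)(D²u v)) ] dμ = −∫_{[0,1]ⁿ} ⟨ D²u(Id − v vᵀ), D²g(∇u) D²u ⟩_F dμ − ∫_{[0,1]ⁿ} ∇g(∇u)·(D²f ∇u) dμ, where ⟨M,N⟩_F = Σ_{i,j} M_{ij}N_{ij} is the Frobenius inner product and Δ_f u = Δu − ∇f·∇u. -/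

import Mathlib

noncomputable section

open MeasureTheory

variable {n : ℕ}

/-- `i`-th partial derivative. -/
def pderiv1 (u : (Fin n → ℝ) → ℝ) (i : Fin n) (x : Fin n → ℝ) : ℝ :=
  fderiv ℝ u x (Pi.single i 1)

/-- Gradient. -/
def grad (u : (Fin n → ℝ) → ℝ) (x : Fin n → ℝ) : Fin n → ℝ :=
  fun i => pderiv1 u i x

/-- Hessian matrix. -/
def hess (u : (Fin n → ℝ) → ℝ) (x : Fin n → ℝ) : Matrix (Fin n) (Fin n) ℝ :=
  Matrix.of fun i j => pderiv1 (pderiv1 u j) i x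

/-- Laplacian. -/
def lap (u : (Fin n → ℝ) → ℝ) (x : Fin n → ℝ) : ℝ :=
  ∑ i, pderiv1 (pderiv1 u i) i x

/-- Euclidean dot product. -/
def dot (a b : Fin n → ℝ) : ℝ := ∑ i, a i * b i

/-- ℤⁿ-periodicity. -/
def ZPeriodic (u : (Fin n → ℝ) → ℝ) : Prop :=
  ∀ (x : Fin n → ℝ) (k : Fin n → ℤ), u (x + fun i => (k i : ℝ)) = u x

/-- Area element `Q(p) = √(1+|p|²)`. -/
def Qe (p : Fin n → ℝ) : ℝ := Real.sqrt (1 + ∑ i, p i ^ 2)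

/-- `v(p) = p / √(1+|p|²)`. -/
def vv (p : Fin n → ℝ) : Fin n → ℝ := fun i => p i / Qe p

/-- Divergence of a vector field. -/
def dvg (V : (Fin n → ℝ) → (Fin n → ℝ)) (x : Fin n → ℝ) : ℝ :=
  ∑ i, fderiv ℝ (fun y => V y i) x (Pi.single i 1)

/-- Weighted divergence `div_f V = div V − ∇f·V`. -/
def divf (f : (Fin n → ℝ) → ℝ) (V : (Fin n → ℝ) → (Fin n → ℝ)) (x : Fin n → ℝ) : ℝ :=
  dvg V x - dot (grad f x) (V x)

/-- Frobenius inner product of matrices. -/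
def frob (A B : Matrix (Fin n) (Fin n) ℝ) : ℝ := ∑ i, ∑ j, A i j * B i j

theorem contDiff_pderiv1 {u : (Fin n → ℝ) → ℝ} {k m : WithTop ℕ∞} (hu : ContDiff ℝ k u)
    (hmk : m + 1 ≤ k) (i : Fin n) : ContDiff ℝ m (pderiv1 u i) :=
  (hu.fderiv_right hmk).clm_apply contDiff_const

theorem contDiff_grad {u : (Fin n → ℝ) → ℝ} {k m : WithTop ℕ∞} (hu : ContDiff ℝ k u)
    (hmk : m + 1 ≤ k) : ContDiff ℝ m (grad u) :=
  contDiff_pi.2 fun i => contDiff_pderiv1 hu hmk i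

theorem pderiv1_comm {u : (Fin n → ℝ) → ℝ} (hu : ContDiff ℝ 2 u) (i j : Fin n)
    (x : Fin n → ℝ) : pderiv1 (pderiv1 u i) j x = pderiv1 (pderiv1 u j) i x := by
  have hd : DifferentiableAt ℝ (fderiv ℝ u) x :=
    (hu.fderiv_right (m := 1) (by norm_num)).differentiable (by norm_num) x
  have key : ∀ a b : Fin n, pderiv1 (pderiv1 u a) b x
      = fderiv ℝ (fderiv ℝ u) x (Pi.single b 1) (Pi.single a 1) := by
    intro a b
    change fderiv ℝ (fun y => fderiv ℝ u y (Pi.single a 1)) x (Pi.single b 1) = _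
    rw [fderiv_clm_apply hd (differentiableAt_const _)]
    simp
  rw [key, key]
  exact (hu.contDiffAt.isSymmSndFDerivAt (by simp)).eq _ _

theorem ZPeriodic.pderiv1 {u : (Fin n → ℝ) → ℝ} (hu : ZPeriodic u) (i : Fin n) :
    ZPeriodic (pderiv1 u i) := by
  intro x k
  have h : (fun y => u (y + fun i => (k i : ℝ))) = u := funext fun y => hu y k
  have h2 := fderiv_comp_add_right (𝕜 := ℝ) (f := u) (x := x) (fun i => (k i : ℝ))
  rw [h] at h2
  simp only [_root_.pderiv1, h2]

theorem ZPeriodic.grad {u : (Fin n → ℝ) → ℝ} (hu : ZPeriodic u) (x : Fin n → ℝ)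
    (k : Fin n → ℤ) : grad u (x + fun i => (k i : ℝ)) = grad u x :=
  funext fun i => hu.pderiv1 i x k

theorem pderiv1_mul {a b : (Fin n → ℝ) → ℝ} {x : Fin n → ℝ} (ha : DifferentiableAt ℝ a x)
    (hb : DifferentiableAt ℝ b x) (i : Fin n) :
    pderiv1 (fun y => a y * b y) i x = pderiv1 a i x * b x + a x * pderiv1 b i x := by
  simp only [pderiv1]
  rw [fderiv_fun_mul ha hb]
  simp
  ring

theorem pderiv1_sub {a b : (Fin n → ℝ) → ℝ} {x : Fin n → ℝ} (ha : DifferentiableAt ℝ a x)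
    (hb : DifferentiableAt ℝ b x) (i : Fin n) :
    pderiv1 (fun y => a y - b y) i x = pderiv1 a i x - pderiv1 b i x := by
  simp only [pderiv1]
  rw [fderiv_fun_sub ha hb]
  simp

theorem pderiv1_sum {ι : Type*} {s : Finset ι} {a : ι → (Fin n → ℝ) → ℝ} {x : Fin n → ℝ}
    (ha : ∀ j ∈ s, DifferentiableAt ℝ (a j) x) (i : Fin n) :
    pderiv1 (fun y => ∑ j ∈ s, a j y) i x = ∑ j ∈ s, pderiv1 (a j) i x := by
  simp only [pderiv1]
  rw [fderiv_fun_sum ha]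
  simp

theorem pderiv1_exp_neg {f : (Fin n → ℝ) → ℝ} {x : Fin n → ℝ} (hf : DifferentiableAt ℝ f x)
    (i : Fin n) :
    pderiv1 (fun y => Real.exp (-f y)) i x = -pderiv1 f i x * Real.exp (-f x) := by
  simp only [pderiv1]
  rw [fderiv_exp hf.fun_neg, fderiv_fun_neg]
  simp
  ring

theorem pderiv1_comp_grad {G u : (Fin n → ℝ) → ℝ} {x : Fin n → ℝ}
    (hG : DifferentiableAt ℝ G (grad u x)) (hu : DifferentiableAt ℝ (grad u) x) (i : Fin n) :
    pderiv1 (fun y => G (grad u y)) i x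
      = ∑ l, pderiv1 G l (grad u x) * pderiv1 (pderiv1 u l) i x := by
  have h1 : fderiv ℝ (fun y => G (grad u y)) x
      = (fderiv ℝ G (grad u x)).comp (fderiv ℝ (grad u) x) := fderiv_comp x hG hu
  have h2 : ∀ l, fderiv ℝ (grad u) x (Pi.single i 1) l = pderiv1 (pderiv1 u l) i x := fun l => by
    have h := (hasFDerivAt_pi'.1 hu.hasFDerivAt l).fderiv
    exact (congrArg (fun L => L (Pi.single i 1)) h).symm
  simp only [pderiv1] at h2 ⊢
  rw [h1, ContinuousLinearMap.comp_apply,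
    pi_eq_sum_univ' (fderiv ℝ (grad u) x (Pi.single i 1)), map_sum]
  refine Finset.sum_congr rfl fun l _ => ?_
  rw [map_smul, h2, smul_eq_mul, mul_comm]

/-- The divergence of a periodic `C¹` vector field integrates to zero over the unit cube. -/
theorem integral_dvg_eq_zero {V : (Fin n → ℝ) → (Fin n → ℝ)}
    (hV : ContDiff ℝ 1 V) (hp : ∀ i, ZPeriodic fun x => V x i) :
    ∫ x in Set.Icc (0 : Fin n → ℝ) 1, dvg V x = 0 := by
  have hVi : ∀ i, ContDiff ℝ 1 fun x => V x i := contDiff_pi.1 hV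
  have hc : Continuous (dvg V) :=
    continuous_finsetSum _ fun i _ =>
      (contDiff_pderiv1 (m := 0) (hVi i) (by norm_num) i).continuous
  cases n with
  | zero => simp [dvg]
  | succ m =>
    have h := integral_divergence_of_hasFDerivAt_off_countable' (E := ℝ)
      (0 : Fin (m + 1) → ℝ) 1 zero_le_one
      (fun i x => V x i) (fun i x => fderiv ℝ (fun y => V y i) x) ∅ Set.countable_empty
      (fun i => (hVi i).continuous.continuousOn)
      (fun x _ i => ((hVi i).differentiable (by norm_num) x).hasFDerivAt)
      (hc.continuousOn.integrableOn_compact isCompact_Icc)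
    refine h.trans (Finset.sum_eq_zero fun i _ => sub_eq_zero.2 ?_)
    refine integral_congr_ae (Filter.Eventually.of_forall fun y => ?_)
    have hk := hp i (i.insertNth (0 : ℝ) y) (Pi.single i 1)
    have he : (i.insertNth (0 : ℝ) y + fun j => (((Pi.single i 1 : Fin (m + 1) → ℤ) j : ℤ) : ℝ))
        = i.insertNth (1 : ℝ) y := by
      ext j
      refine Fin.succAboveCases i ?_ (fun j => ?_) j <;> simp
    rw [he] at hk
    exact hk

theorem frob_mul_one_sub_vecMulVec (A B : Matrix (Fin n) (Fin n) ℝ) (v : Fin n → ℝ) :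
    frob (A * (1 - Matrix.vecMulVec v v)) B
      = frob A B - dot (A.mulVec v) (B.mulVec v) := by
  rw [mul_sub, mul_one, Matrix.mul_vecMulVec]
  simp only [frob, dot, Matrix.sub_apply, Matrix.vecMulVec_apply, sub_mul,
    Finset.sum_sub_distrib]
  congr 1
  refine Finset.sum_congr rfl fun i _ => ?_
  rw [Matrix.mulVec.eq_def B v]
  simp only [dotProduct, Finset.mul_sum]
  exact Finset.sum_congr rfl fun j _ => by ring

/-- The derivative of the drift Laplacian: `∂ₖ(Δ_f u) = Δ_f(∂ₖ u) - (D²f ∇u)ₖ`. -/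
theorem grad_drift_laplacian {f u : (Fin n → ℝ) → ℝ} (hf : ContDiff ℝ 2 f)
    (hu : ContDiff ℝ 3 u) (x : Fin n → ℝ) (k : Fin n) :
    grad (fun y => lap u y - dot (grad f y) (grad u y)) x k
      = ∑ i, (pderiv1 (pderiv1 (pderiv1 u k) i) i x
          - pderiv1 f i x * pderiv1 (pderiv1 u k) i x)
        - (hess f x).mulVec (grad u x) k := by
  have hu2 : ContDiff ℝ 2 u := hu.of_le (by norm_num)
  have hu1 : ∀ i, ContDiff ℝ 2 (pderiv1 u i) := contDiff_pderiv1 hu (by norm_num)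
  have hd1 : ∀ i, DifferentiableAt ℝ (pderiv1 u i) x := fun i =>
    (hu1 i).differentiable (by norm_num) x
  have hd2 : ∀ i j, DifferentiableAt ℝ (pderiv1 (pderiv1 u i) j) x := fun i j =>
    (contDiff_pderiv1 (m := 1) (hu1 i) (by norm_num) j).differentiable (by norm_num) x
  have hdf : ∀ i, DifferentiableAt ℝ (pderiv1 f i) x := fun i =>
    (contDiff_pderiv1 (m := 1) hf (by norm_num) i).differentiable (by norm_num) x
  have hdp : ∀ i ∈ Finset.univ, DifferentiableAt ℝ (fun y => pderiv1 f i y * pderiv1 u i y) x :=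
    fun i _ => (hdf i).mul (hd1 i)
  have hcomm : ∀ i, pderiv1 (pderiv1 (pderiv1 u i) i) k x
      = pderiv1 (pderiv1 (pderiv1 u k) i) i x := fun i => by
    rw [pderiv1_comm (hu1 i), funext (pderiv1_comm hu2 i k)]
  simp only [grad, lap, dot]
  rw [pderiv1_sub (DifferentiableAt.fun_sum fun i _ => hd2 i i) (DifferentiableAt.fun_sum hdp),
    pderiv1_sum (fun i _ => hd2 i i), pderiv1_sum hdp]
  simp only [Matrix.mulVec, dotProduct, hess, Matrix.of_apply]
  rw [← Finset.sum_sub_distrib, ← Finset.sum_sub_distrib]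
  refine Finset.sum_congr rfl fun i _ => ?_
  rw [pderiv1_mul (hdf i) (hd1 i), hcomm, pderiv1_comm hu2 i k, grad]
  ring

/-- The weighted field `e^{-f} D²u ∇g(∇u)`. -/
def weightedField (f u g : (Fin n → ℝ) → ℝ) (x : Fin n → ℝ) : Fin n → ℝ := fun i =>
  ∑ k, pderiv1 g k (grad u x) * pderiv1 (pderiv1 u k) i x * Real.exp (-f x)

theorem contDiff_weightedField {f u g : (Fin n → ℝ) → ℝ} (hf : ContDiff ℝ 1 f)
    (hu : ContDiff ℝ 3 u) (hg : ContDiff ℝ 2 g) : ContDiff ℝ 1 (weightedField f u g) :=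
  contDiff_pi.2 fun i => ContDiff.sum fun k _ =>
    (((contDiff_pderiv1 hg (by norm_num) k).comp (contDiff_grad hu (by norm_num))).mul
      (contDiff_pderiv1 (contDiff_pderiv1 (m := 2) hu (by norm_num) k) (by norm_num) i)).mul
      hf.neg.exp

theorem dvg_weightedField {f u g : (Fin n → ℝ) → ℝ} (hf : ContDiff ℝ 1 f)
    (hu : ContDiff ℝ 3 u) (hg : ContDiff ℝ 2 g) (x : Fin n → ℝ) :
    dvg (weightedField f u g) x
      = (frob (hess u x) (hess g (grad u x) * hess u x)
        + ∑ k, pderiv1 g k (grad u x) * ∑ i, (pderiv1 (pderiv1 (pderiv1 u k) i) i x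
          - pderiv1 f i x * pderiv1 (pderiv1 u k) i x)) * Real.exp (-f x) := by
  have hu2 : ContDiff ℝ 2 u := hu.of_le (by norm_num)
  have hG : ∀ k, ContDiff ℝ 1 (pderiv1 g k) := contDiff_pderiv1 hg (by norm_num)
  have hgu : ContDiff ℝ 1 (grad u) := contDiff_grad hu (by norm_num)
  have hdG : ∀ k, DifferentiableAt ℝ (fun y => pderiv1 g k (grad u y)) x := fun k =>
    ((hG k).comp hgu).differentiable (by norm_num) x
  have hd2 : ∀ k i, DifferentiableAt ℝ (pderiv1 (pderiv1 u k) i) x := fun k i =>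
    (contDiff_pderiv1 (m := 1) (contDiff_pderiv1 (m := 2) hu (by norm_num) k)
      (by norm_num) i).differentiable (by norm_num) x
  have hfx : DifferentiableAt ℝ f x := hf.differentiable (by norm_num) x
  have hterm : ∀ i, fderiv ℝ (fun y => weightedField f u g y i) x (Pi.single i 1)
      = ∑ k, ((∑ l, pderiv1 (pderiv1 g k) l (grad u x) * pderiv1 (pderiv1 u l) i x)
            * pderiv1 (pderiv1 u k) i x
          + pderiv1 g k (grad u x) * (pderiv1 (pderiv1 (pderiv1 u k) i) i x
            - pderiv1 f i x * pderiv1 (pderiv1 u k) i x)) * Real.exp (-f x) := by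
    intro i
    change pderiv1 (fun y => ∑ k, pderiv1 g k (grad u y) * pderiv1 (pderiv1 u k) i y
      * Real.exp (-f y)) i x = _
    rw [pderiv1_sum fun k _ => ((hdG k).fun_mul (hd2 k i)).fun_mul hfx.fun_neg.exp]
    refine Finset.sum_congr rfl fun k _ => ?_
    rw [pderiv1_mul ((hdG k).fun_mul (hd2 k i)) hfx.fun_neg.exp, pderiv1_mul (hdG k) (hd2 k i),
      pderiv1_exp_neg hfx, pderiv1_comp_grad ((hG k).differentiable (by norm_num) _)
        (hgu.differentiable (by norm_num) x)]
    ring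
  simp only [dvg, hterm]
  simp only [← Finset.sum_mul, Finset.sum_add_distrib]
  congr 2
  · rw [frob, Finset.sum_comm]
    simp only [Finset.sum_mul, Matrix.mul_apply, hess, Matrix.of_apply, Finset.mul_sum]
    refine Finset.sum_congr rfl fun k _ => Finset.sum_congr rfl fun i _ =>
      Finset.sum_congr rfl fun l _ => ?_
    rw [pderiv1_comm hg k l, pderiv1_comm hu2 l i, pderiv1_comm hu2 k i]
    ring
  · rw [Finset.sum_comm]
    simp only [Finset.mul_sum]

/-- the term `λ_pert`: writing `v = v(∇u)`,
`∫ [∇g(∇u)·∇(Δ_f u) + (D²u v)·(D²g(∇u)(D²u v))] dμ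
  = −∫ ⟨D²u(Id − v vᵀ), D²g(∇u) D²u⟩_F dμ − ∫ ∇g(∇u)·(D²f ∇u) dμ`
for smooth periodic `f, u` and `g ∈ C²`, with `dμ = e^{-f} dx` on `[0,1]ⁿ`. -/
theorem lambda_pert_identity
    (f u g : (Fin n → ℝ) → ℝ)
    (hf : ContDiff ℝ (⊤ : ℕ∞) f) (hu : ContDiff ℝ (⊤ : ℕ∞) u)
    (hg : ContDiff ℝ 2 g)
    (hfp : ZPeriodic f) (hup : ZPeriodic u) :
    ∫ x in Set.Icc (0 : Fin n → ℝ) 1,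
        (dot (grad g (grad u x))
            (grad (fun y => lap u y - dot (grad f y) (grad u y)) x)
          + dot ((hess u x).mulVec (vv (grad u x)))
              ((hess g (grad u x)).mulVec ((hess u x).mulVec (vv (grad u x)))))
          * Real.exp (-f x) =
      -(∫ x in Set.Icc (0 : Fin n → ℝ) 1,
          frob (hess u x *
              ((1 : Matrix (Fin n) (Fin n) ℝ)
                - Matrix.vecMulVec (vv (grad u x)) (vv (grad u x))))
            (hess g (grad u x) * hess u x) * Real.exp (-f x))
      - ∫ x in Set.Icc (0 : Fin n → ℝ) 1,
          dot (grad g (grad u x)) ((hess f x).mulVec (grad u x)) * Real.exp (-f x) := by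
  have hu3 : ContDiff ℝ 3 u := hu.of_le (WithTop.coe_le_coe.2 le_top)
  have hf2 : ContDiff ℝ 2 f := hf.of_le (WithTop.coe_le_coe.2 le_top)
  have hf1 : ContDiff ℝ 1 f := hf2.of_le (by norm_num)
  have hVp : ∀ i, ZPeriodic fun x => weightedField f u g x i := fun i x k => by
    simp only [weightedField, hup.grad x k, ((hup.pderiv1 _).pderiv1 i) x k, hfp x k]
  have hV := contDiff_weightedField hf1 hu3 hg
  have hgrad : Continuous (grad u) := (contDiff_grad (m := 2) hu3 (by norm_num)).continuous
  have hhess : Continuous (hess u) := continuous_matrix fun i j =>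
    (contDiff_pderiv1 (m := 1) (contDiff_pderiv1 (m := 2) hu3 (by norm_num) j)
      (by norm_num) i).continuous
  have hhessf : Continuous (hess f) := continuous_matrix fun i j =>
    (contDiff_pderiv1 (m := 0) (contDiff_pderiv1 (m := 1) hf2 (by norm_num) j)
      (by norm_num) i).continuous
  have hhessg : Continuous fun x => hess g (grad u x) :=
    (continuous_matrix fun i j =>
      (contDiff_pderiv1 (m := 0) (contDiff_pderiv1 (m := 1) hg (by norm_num) j)
        (by norm_num) i).continuous).comp hgrad
  have hgg : Continuous fun x => grad g (grad u x) :=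
    (contDiff_grad (m := 1) hg (by norm_num)).continuous.comp hgrad
  have hvv : Continuous fun x => vv (grad u x) := by
    have hQ : Continuous fun x => Qe (grad u x) := by
      unfold Qe
      fun_prop
    refine continuous_pi fun i => ((continuous_apply i).comp hgrad).div hQ fun x => ?_
    exact (Real.sqrt_pos.2 (by positivity)).ne'
  have hexp : Continuous fun x => Real.exp (-f x) := hf.continuous.neg.rexp
  have hdot : ∀ {a b : (Fin n → ℝ) → Fin n → ℝ}, Continuous a → Continuous b →
      Continuous fun x => dot (a x) (b x) := fun ha hb => ha.dotProduct hb
  have hfrob : ∀ {A B : (Fin n → ℝ) → Matrix (Fin n) (Fin n) ℝ}, Continuous A → Continuous B →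
      Continuous fun x => frob (A x) (B x) := fun ha hb =>
    continuous_finsetSum _ fun i _ => continuous_finsetSum _ fun j _ =>
      (ha.matrix_elem i j).mul (hb.matrix_elem i j)
  have hint : ∀ {h : (Fin n → ℝ) → ℝ}, Continuous h →
      IntegrableOn h (Set.Icc (0 : Fin n → ℝ) 1) := fun hh =>
    hh.continuousOn.integrableOn_compact isCompact_Icc
  have hiV : IntegrableOn (dvg (weightedField f u g)) (Set.Icc (0 : Fin n → ℝ) 1) :=
    hint (continuous_finsetSum _ fun i _ =>
      (contDiff_pderiv1 (m := 0) (contDiff_pi.1 hV i) (by norm_num) i).continuous)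
  have hiA : IntegrableOn (fun x => frob (hess u x * ((1 : Matrix (Fin n) (Fin n) ℝ)
      - Matrix.vecMulVec (vv (grad u x)) (vv (grad u x)))) (hess g (grad u x) * hess u x)
        * Real.exp (-f x)) (Set.Icc (0 : Fin n → ℝ) 1) :=
    hint ((hfrob (hhess.matrix_mul (continuous_const.sub (hvv.matrix_vecMulVec hvv)))
      (hhessg.matrix_mul hhess)).mul hexp)
  have hiB : IntegrableOn (fun x => dot (grad g (grad u x)) ((hess f x).mulVec (grad u x))
      * Real.exp (-f x)) (Set.Icc (0 : Fin n → ℝ) 1) :=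
    hint ((hdot hgg (hhessf.matrix_mulVec hgrad)).mul hexp)
  rw [← zero_sub (∫ x in _, frob _ _ * _), ← integral_dvg_eq_zero hV hVp,
    ← integral_sub hiV hiA, ← integral_sub (hiV.fun_sub hiA) hiB]
  congr 1
  ext x
  rw [dvg_weightedField hf1 hu3 hg, frob_mul_one_sub_vecMulVec, ← Matrix.mulVec_mulVec]
  have hk : dot (grad g (grad u x)) (grad (fun y => lap u y - dot (grad f y) (grad u y)) x)
      = ∑ k, pderiv1 g k (grad u x) * ∑ i, (pderiv1 (pderiv1 (pderiv1 u k) i) i x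
          - pderiv1 f i x * pderiv1 (pderiv1 u k) i x)
        - dot (grad g (grad u x)) ((hess f x).mulVec (grad u x)) := by
    rw [dot, dot, ← Finset.sum_sub_distrib]
    refine Finset.sum_congr rfl fun k _ => ?_
    rw [grad_drift_laplacian hf2 hu3 x k, mul_sub]
    rfl
  rw [hk]
  ring
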